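/- Let α ∈ ((n−1)/n, 1). There exists a constant C, depending only on n, Ω and α, such that for all maps u, v that are continuously differentiable up to the boundary of Ω with values in ℝ^n and every ψ ∈ C^1_c(Ω), one has |⟨Ju,ψ⟩ − ⟨Jv,ψ⟩| ≤ C ‖u−v‖_{C^{0,α}(Ω)} (‖u‖_{C^{0,α}(Ω)} + ‖v‖_{C^{0,α}(Ω)})^{n−1} ‖∇ψ‖_{L^1(Ω)}. -/

import Mathlib

open MeasureTheory Metric Filter Topology

noncomputable section

abbrev Euc (n : ℕ) := EuclideanSpace ℝ (Fin n)

/-- The Jacobian matrix `∇u(x)` of a map `u : ℝⁿ → ℝⁿ`, with entries `∂_j u_i (x)`. -/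
def jacMat (n : ℕ) (u : Euc n → Euc n) (x : Euc n) : Matrix (Fin n) (Fin n) ℝ :=
  Matrix.of fun i j => fderiv ℝ u x (EuclideanSpace.single j 1) i

/-- The vector field `j u := (1/n) (cof ∇u)ᵀ u` (componentwise); note that
`(cof A)ᵀ = adjugate A`. -/
def jvec (n : ℕ) (u : Euc n → Euc n) (x : Euc n) : Fin n → ℝ :=
  fun i => (n : ℝ)⁻¹ * Matrix.mulVec (Matrix.adjugate (jacMat n u x)) (fun j => u x j) i

/-- The pointwise pairing `j u (x) · ∇ψ(x)`. -/
def jPair (n : ℕ) (u : Euc n → Euc n) (ψ : Euc n → ℝ) (x : Euc n) : ℝ :=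
  ∑ i, jvec n u x i * fderiv ℝ ψ x (EuclideanSpace.single i 1)

/-- `ψ ∈ C¹_c(Ω)`. -/
def Cc1 (n : ℕ) (Ω : Set (Euc n)) (ψ : Euc n → ℝ) : Prop :=
  ContDiff ℝ 1 ψ ∧ HasCompactSupport ψ ∧ tsupport ψ ⊆ Ω

/-- The fractional Sobolev seminorm `[u]_{W^{s,p}(Ω)}`. -/
def sobSemi (n : ℕ) (s p : ℝ) (Ω : Set (Euc n)) {F : Type*} [NormedAddCommGroup F]
    (u : Euc n → F) : ℝ :=
  (∫ x in Ω, ∫ y in Ω, ‖u x - u y‖ ^ p / dist x y ^ ((n : ℝ) + s * p)) ^ (1 / p)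

/-- The fractional Sobolev norm `‖u‖_{W^{s,p}(Ω)} = ‖u‖_{L^p(Ω)} + [u]_{W^{s,p}(Ω)}`. -/
def sobNorm (n : ℕ) (s p : ℝ) (Ω : Set (Euc n)) {F : Type*} [NormedAddCommGroup F]
    (u : Euc n → F) : ℝ :=
  (∫ x in Ω, ‖u x‖ ^ p) ^ (1 / p) + sobSemi n s p Ω u

/-- Membership `u ∈ W^{s,p}(Ω; F)`: `u ∈ L^p(Ω)` and the double integral defining
`[u]_{W^{s,p}(Ω)}^p` is finite. -/
def MemWsp (n : ℕ) (s p : ℝ) (Ω : Set (Euc n)) {F : Type*} [NormedAddCommGroup F]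
    (u : Euc n → F) : Prop :=
  AEStronglyMeasurable u (volume.restrict Ω) ∧
  Integrable (fun x => ‖u x‖ ^ p) (volume.restrict Ω) ∧
  Integrable (fun q : Euc n × Euc n => ‖u q.1 - u q.2‖ ^ p / dist q.1 q.2 ^ ((n : ℝ) + s * p))
    ((volume.restrict Ω).prod (volume.restrict Ω))

/-- `Ω` has smooth boundary: it is a sublevel set of a smooth function whose
differential does not vanish on the boundary. -/
def SmoothBoundary (n : ℕ) (Ω : Set (Euc n)) : Prop :=
  ∃ f : Euc n → ℝ, ContDiff ℝ (⊤ : ℕ∞) f ∧ Ω = f ⁻¹' Set.Iio 0 ∧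
    ∀ x ∈ frontier Ω, fderiv ℝ f x ≠ 0

/-- `u^a(x) = (u(x) - a)/|u(x) - a|`. -/
def proj (n : ℕ) (u : Euc n → Euc n) (a : Euc n) : Euc n → Euc n :=
  fun x => ‖u x - a‖⁻¹ • (u x - a)

/-- The set of Hölder quotients of `u` on `Ω`. -/
def holderSet (n : ℕ) (α : ℝ) (Ω : Set (Euc n)) {F : Type*} [NormedAddCommGroup F]
    (u : Euc n → F) : Set ℝ :=
  {r | ∃ x ∈ Ω, ∃ y ∈ Ω, x ≠ y ∧ r = ‖u x - u y‖ / dist x y ^ α}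

/-- The Hölder seminorm `[u]_{C^{0,α}(Ω)}`. -/
def holderSemi (n : ℕ) (α : ℝ) (Ω : Set (Euc n)) {F : Type*} [NormedAddCommGroup F]
    (u : Euc n → F) : ℝ :=
  sSup (holderSet n α Ω u)

/-- The Hölder norm `‖u‖_{C^{0,α}(Ω)} = sup_Ω ‖u‖ + [u]_{C^{0,α}(Ω)}`. -/
def holderNorm (n : ℕ) (α : ℝ) (Ω : Set (Euc n)) {F : Type*} [NormedAddCommGroup F]
    (u : Euc n → F) : ℝ :=
  sSup {r | ∃ x ∈ Ω, r = ‖u x‖} + holderSemi n α Ω u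

/-- the volume `ω_n` of the unit ball of `ℝⁿ`. -/
def ballVol (n : ℕ) : ℝ := (volume (ball (0 : Euc n) 1)).toReal

/-- `⟨Jv, ψ⟩ = J` for `v ∈ W^{(n-1)/n, n}(Ω; ℝⁿ)`: approximating sequences of maps which are
`C¹` up to the boundary exist, and for every such sequence the Jacobian integrals converge
to `J`. -/
def JPairing (n : ℕ) (Ω : Set (Euc n)) (v : Euc n → Euc n) (ψ : Euc n → ℝ) (J : ℝ) : Prop :=
  (∃ vk : ℕ → Euc n → Euc n, (∀ k, ContDiffOn ℝ 1 (vk k) (closure Ω)) ∧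
      Tendsto (fun k => sobNorm n (((n : ℝ) - 1) / n) n Ω (vk k - v)) atTop (𝓝 0) ∧
      Tendsto (fun k => ∫ x in Ω, (jacMat n (vk k) x).det * ψ x) atTop (𝓝 J)) ∧
  (∀ vk : ℕ → Euc n → Euc n, (∀ k, ContDiffOn ℝ 1 (vk k) (closure Ω)) →
      Tendsto (fun k => sobNorm n (((n : ℝ) - 1) / n) n Ω (vk k - v)) atTop (𝓝 0) →
      Tendsto (fun k => ∫ x in Ω, (jacMat n (vk k) x).det * ψ x) atTop (𝓝 J))

/-- The set of values `⟨Jv, ψ⟩` over test functions `ψ ∈ C¹_c(Ω)` with `|ψ| ≤ 1`;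
its supremum is the total variation `|Jv|_{TV}`. -/
def TVset (n : ℕ) (Ω : Set (Euc n)) (v : Euc n → Euc n) : Set ℝ :=
  {r | ∃ ψ : Euc n → ℝ, Cc1 n Ω ψ ∧ (∀ x, |ψ x| ≤ 1) ∧ JPairing n Ω v ψ r}

/-- `⟨Jv, ψ⟩ = -∫_Ω j v · ∇ψ` for (pointwise defined) `v`. -/
def jpairOn (n : ℕ) (Ω : Set (Euc n)) (v : Euc n → Euc n) (ψ : Euc n → ℝ) : ℝ :=
  -∫ x in Ω, jPair n v ψ x

/-- The `W^{-1,1}(Ω)` distance between two functionals on test functions: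
`sup { S ψ - T ψ : ψ ∈ C¹_c(Ω), Lip ψ ≤ 1 }`. -/
def Wm11dist (n : ℕ) (Ω : Set (Euc n)) (S T : (Euc n → ℝ) → ℝ) : ℝ :=
  sSup {r | ∃ ψ : Euc n → ℝ, Cc1 n Ω ψ ∧ LipschitzWith 1 ψ ∧ r = S ψ - T ψ}

/-- The Jacobian determinant of an `n`-tuple of scalar functions, as a Leibniz sum. -/
def jd {n : ℕ} (f : Fin n → Euc n → ℝ) (x : Euc n) : ℝ :=
  ∑ σ : Equiv.Perm (Fin n), ((Equiv.Perm.sign σ : ℤ) : ℝ) *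
    ∏ i, fderiv ℝ (f i) x (EuclideanSpace.single (σ i) 1)

lemma jd_split {n : ℕ} (f : Fin n → Euc n → ℝ) (g : Euc n → ℝ) (i0 : Fin n) (x : Euc n) :
    jd (Function.update f i0 g) x = ∑ σ : Equiv.Perm (Fin n), ((Equiv.Perm.sign σ : ℤ) : ℝ) *
      (fderiv ℝ g x (EuclideanSpace.single (σ i0) 1) *
        ∏ i ∈ Finset.univ.erase i0, fderiv ℝ (f i) x (EuclideanSpace.single (σ i) 1)) := by
  unfold jd
  refine Finset.sum_congr rfl fun σ _ => ?_
  congr 1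
  rw [← Finset.mul_prod_erase _ _ (Finset.mem_univ i0)]
  congr 1
  · simp
  · refine Finset.prod_congr rfl fun i hi => ?_
    rw [Function.update_of_ne (Finset.ne_of_mem_erase hi)]

lemma jd_split' {n : ℕ} (f : Fin n → Euc n → ℝ) (i0 : Fin n) (x : Euc n) :
    jd f x = ∑ σ : Equiv.Perm (Fin n), ((Equiv.Perm.sign σ : ℤ) : ℝ) *
      (fderiv ℝ (f i0) x (EuclideanSpace.single (σ i0) 1) *
        ∏ i ∈ Finset.univ.erase i0, fderiv ℝ (f i) x (EuclideanSpace.single (σ i) 1)) := by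
  have := jd_split f (f i0) i0 x
  rwa [Function.update_eq_self] at this

lemma piola_cancel {n : ℕ} (B : Fin n → Fin n → ℝ) (S : Fin n → Fin n → ℝ)
    (hS : ∀ a b, S a b = S b a) (i0 l : Fin n) (hl : l ≠ i0) :
    ∑ σ : Equiv.Perm (Fin n), ((Equiv.Perm.sign σ : ℤ) : ℝ) *
      ((∏ j ∈ (Finset.univ.erase i0).erase l, B j (σ j)) * S (σ i0) (σ l)) = 0 := by
  set F : Equiv.Perm (Fin n) → ℝ := fun σ => ((Equiv.Perm.sign σ : ℤ) : ℝ) *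
      ((∏ j ∈ (Finset.univ.erase i0).erase l, B j (σ j)) * S (σ i0) (σ l)) with hF
  have h1 : ∑ σ, F σ = ∑ σ, F (σ * Equiv.swap i0 l) :=
    (Equiv.sum_comp (Equiv.mulRight (Equiv.swap i0 l)) F).symm
  have h2 : ∀ σ, F (σ * Equiv.swap i0 l) = - F σ := by
    intro σ
    simp only [hF, Equiv.Perm.sign_mul, Equiv.Perm.sign_swap hl.symm, Equiv.Perm.mul_apply,
      Equiv.swap_apply_left, Equiv.swap_apply_right]
    rw [hS (σ l) (σ i0)]
    have : ∏ j ∈ (Finset.univ.erase i0).erase l, B j (σ (Equiv.swap i0 l j))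
        = ∏ j ∈ (Finset.univ.erase i0).erase l, B j (σ j) := by
      refine Finset.prod_congr rfl fun j hj => ?_
      have hj1 : j ≠ l := Finset.ne_of_mem_erase hj
      have hj2 : j ≠ i0 := Finset.ne_of_mem_erase (Finset.mem_of_mem_erase hj)
      rw [Equiv.swap_apply_of_ne_of_ne hj2 hj1]
    rw [this]
    push_cast
    ring
  simp only [h2, Finset.sum_neg_distrib] at h1
  linarith

lemma jd_ibp {n : ℕ} (f : Fin n → Euc n → ℝ) (hf : ∀ i, ContDiff ℝ 2 (f i))
    (ψ : Euc n → ℝ) (hψ : ContDiff ℝ 1 ψ) (hc : HasCompactSupport ψ) (i0 : Fin n) :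
    ∫ x, jd f x * ψ x = - ∫ x, f i0 x * jd (Function.update f i0 ψ) x := by
  set G : Equiv.Perm (Fin n) → Euc n → ℝ := fun σ x =>
    ψ x * ∏ i ∈ Finset.univ.erase i0, fderiv ℝ (f i) x (EuclideanSpace.single (σ i) 1) with hG
  have hd : ∀ i v, ContDiff ℝ 1 (fun x => fderiv ℝ (f i) x v) := fun i v =>
    ((hf i).fderiv_right (m := 1) (by norm_num)).clm_apply contDiff_const
  have hGc : ∀ σ, ContDiff ℝ 1 (G σ) := by
    intro σ
    exact hψ.mul (contDiff_prod fun i _ => hd i _)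
  have hGs : ∀ σ, HasCompactSupport (G σ) := fun σ => hc.mul_right
  have hGd : ∀ σ v, Continuous (fun x => fderiv ℝ (G σ) x v) := fun σ v =>
    ((hGc σ).continuous_fderiv (by norm_num)).clm_apply continuous_const
  have hGds : ∀ σ v, HasCompactSupport (fun x => fderiv ℝ (G σ) x v) := fun σ v =>
    (hGs σ).fderiv_apply (𝕜 := ℝ) v
  have i1 : ∀ σ, Integrable (fun x => fderiv ℝ (f i0) x (EuclideanSpace.single (σ i0) 1) * G σ x) := 
    fun σ => ((hd i0 _).continuous.mul (hGc σ).continuous).integrable_of_hasCompactSupport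
      (hGs σ).mul_left
  have i2 : ∀ σ : Equiv.Perm (Fin n), Integrable
      (fun x => f i0 x * fderiv ℝ (G σ) x (EuclideanSpace.single (σ i0) 1)) := 
    fun σ => ((hf i0).continuous.mul (hGd σ _)).integrable_of_hasCompactSupport
      (hGds σ _).mul_left
  have i3 : ∀ σ, Integrable (fun x => f i0 x * G σ x) := 
    fun σ => ((hf i0).continuous.mul (hGc σ).continuous).integrable_of_hasCompactSupport
      (hGs σ).mul_left
  have key : ∀ σ : Equiv.Perm (Fin n),
      ∫ x, fderiv ℝ (f i0) x (EuclideanSpace.single (σ i0) 1) * G σ x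
      = - ∫ x, f i0 x * fderiv ℝ (G σ) x (EuclideanSpace.single (σ i0) 1) := by
    intro σ
    rw [integral_mul_fderiv_eq_neg_fderiv_mul_of_integrable (i1 σ) (i2 σ) (i3 σ)
      (fun x _ => (hf i0).differentiable (by norm_num) x)
      (fun x _ => (hGc σ).differentiable (by norm_num) x), neg_neg]
  have hpt : ∀ x, jd (Function.update f i0 ψ) x = ∑ σ : Equiv.Perm (Fin n),
      ((Equiv.Perm.sign σ : ℤ) : ℝ) * fderiv ℝ (G σ) x (EuclideanSpace.single (σ i0) 1) := by
    intro x
    rw [jd_split]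
    have hGx : ∀ σ : Equiv.Perm (Fin n), fderiv ℝ (G σ) x (EuclideanSpace.single (σ i0) 1) =
        fderiv ℝ ψ x (EuclideanSpace.single (σ i0) 1) *
          ∏ i ∈ Finset.univ.erase i0, fderiv ℝ (f i) x (EuclideanSpace.single (σ i) 1) +
        ψ x * ∑ l ∈ Finset.univ.erase i0,
          (∏ j ∈ (Finset.univ.erase i0).erase l,
            fderiv ℝ (f j) x (EuclideanSpace.single (σ j) 1)) *
          fderiv ℝ (fderiv ℝ (f l)) x (EuclideanSpace.single (σ i0) 1)
            (EuclideanSpace.single (σ l) 1) := by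
      intro σ
      have hp := HasFDerivAt.finsetProd (u := Finset.univ.erase i0) (x := x)
        (g := fun i x => fderiv ℝ (f i) x (EuclideanSpace.single (σ i) 1))
        (g' := fun i => fderiv ℝ (fun x => fderiv ℝ (f i) x (EuclideanSpace.single (σ i) 1)) x)
        (fun i _ => ((hd i _).differentiable (by norm_num) x).hasFDerivAt)
      have hm := ((hψ.differentiable (by norm_num) x).hasFDerivAt).mul hp
      have : fderiv ℝ (G σ) x = _ := hm.fderiv
      rw [this]
      have hsec : ∀ l v w, fderiv ℝ (fun x => fderiv ℝ (f l) x v) x w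
          = fderiv ℝ (fderiv ℝ (f l)) x w v := by
        intro l v w
        rw [fderiv_clm_apply (((hf l).fderiv_right (m := 1) (by norm_num)).differentiable
          (by norm_num) x) (differentiableAt_const v)]
        simp
      simp [hsec]
      ring
    simp only [hGx]
    have hz : ∑ σ : Equiv.Perm (Fin n), ((Equiv.Perm.sign σ : ℤ) : ℝ) * (ψ x *
        ∑ l ∈ Finset.univ.erase i0,
          (∏ j ∈ (Finset.univ.erase i0).erase l,
            fderiv ℝ (f j) x (EuclideanSpace.single (σ j) 1)) *
          fderiv ℝ (fderiv ℝ (f l)) x (EuclideanSpace.single (σ i0) 1)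
            (EuclideanSpace.single (σ l) 1)) = 0 := by
      have : ∀ l ∈ Finset.univ.erase i0, ∑ σ : Equiv.Perm (Fin n),
          ((Equiv.Perm.sign σ : ℤ) : ℝ) * ((∏ j ∈ (Finset.univ.erase i0).erase l,
            fderiv ℝ (f j) x (EuclideanSpace.single (σ j) 1)) *
          fderiv ℝ (fderiv ℝ (f l)) x (EuclideanSpace.single (σ i0) 1)
            (EuclideanSpace.single (σ l) 1)) = 0 := by
        intro l hl
        refine piola_cancel (fun j a => fderiv ℝ (f j) x (EuclideanSpace.single a 1))
          (fun a b => fderiv ℝ (fderiv ℝ (f l)) x (EuclideanSpace.single a 1)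
            (EuclideanSpace.single b 1)) ?_ i0 l (Finset.ne_of_mem_erase hl)
        intro a b
        exact ((hf l).contDiffAt.isSymmSndFDerivAt (by simp)) _ _
      have h2 : ∑ l ∈ Finset.univ.erase i0, ψ x * ∑ σ : Equiv.Perm (Fin n),
          ((Equiv.Perm.sign σ : ℤ) : ℝ) * ((∏ j ∈ (Finset.univ.erase i0).erase l,
            fderiv ℝ (f j) x (EuclideanSpace.single (σ j) 1)) *
          fderiv ℝ (fderiv ℝ (f l)) x (EuclideanSpace.single (σ i0) 1)
            (EuclideanSpace.single (σ l) 1)) = 0 :=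
        Finset.sum_eq_zero fun l hl => by rw [this l hl, mul_zero]
      rw [← h2]
      simp only [Finset.mul_sum]
      rw [Finset.sum_comm]
      refine Finset.sum_congr rfl fun l _ => Finset.sum_congr rfl fun σ _ => by ring
    simp only [mul_add, Finset.sum_add_distrib]
    rw [hz, add_zero]
  have e1 : ∀ x, jd f x * ψ x = ∑ σ : Equiv.Perm (Fin n), ((Equiv.Perm.sign σ : ℤ) : ℝ) *
      (fderiv ℝ (f i0) x (EuclideanSpace.single (σ i0) 1) * G σ x) := by
    intro x
    rw [jd_split' f i0, Finset.sum_mul]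
    refine Finset.sum_congr rfl fun σ _ => ?_
    simp only [hG]; ring
  have e2 : ∀ x, f i0 x * jd (Function.update f i0 ψ) x = ∑ σ : Equiv.Perm (Fin n),
      ((Equiv.Perm.sign σ : ℤ) : ℝ) *
      (f i0 x * fderiv ℝ (G σ) x (EuclideanSpace.single (σ i0) 1)) := by
    intro x
    rw [hpt, Finset.mul_sum]
    refine Finset.sum_congr rfl fun σ _ => ?_
    ring
  simp only [e1, e2]
  rw [integral_finsetSum _ (fun σ _ => (i1 σ).const_mul _),
    integral_finsetSum _ (fun σ _ => (i2 σ).const_mul _), ← Finset.sum_neg_distrib]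
  refine Finset.sum_congr rfl fun σ _ => ?_
  rw [integral_const_mul, integral_const_mul, key]
  ring

lemma jd_abs_le {n : ℕ} (f : Fin n → Euc n → ℝ) (x : Euc n) :
    |jd f x| ≤ (n.factorial : ℝ) * ∏ i, ‖fderiv ℝ (f i) x‖ := by
  unfold jd
  refine (Finset.abs_sum_le_sum_abs _ _).trans ?_
  have : ∀ σ ∈ (Finset.univ : Finset (Equiv.Perm (Fin n))), |((Equiv.Perm.sign σ : ℤ) : ℝ) *
      ∏ i, fderiv ℝ (f i) x (EuclideanSpace.single (σ i) 1)| ≤ ∏ i, ‖fderiv ℝ (f i) x‖ := by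
    intro σ _
    have hs : |((Equiv.Perm.sign σ : ℤ) : ℝ)| = 1 := by
      rcases Int.units_eq_one_or (Equiv.Perm.sign σ) with h | h <;> simp [h]
    rw [abs_mul, hs, one_mul, Finset.abs_prod]
    refine Finset.prod_le_prod (fun _ _ => abs_nonneg _) fun i _ => ?_
    have := (fderiv ℝ (f i) x).le_opNorm (EuclideanSpace.single (σ i) 1)
    simpa using this
  refine (Finset.sum_le_sum this).trans ?_
  simp [Fintype.card_perm]

/-- Basic estimate obtained after one integration by parts. -/
lemma jd_est {n : ℕ} (f : Fin n → Euc n → ℝ) (hf : ∀ i, ContDiff ℝ 2 (f i))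
    (ψ : Euc n → ℝ) (hψ : ContDiff ℝ 1 ψ) (hc : HasCompactSupport ψ) (i0 : Fin n)
    (N : Fin n → ℝ) (a b : ℝ) (hN : ∀ i, 0 ≤ N i) (ha : 0 ≤ a) (hb : 0 ≤ b)
    (h0 : ∀ x ∈ tsupport ψ, |f i0 x| ≤ N i0 * a)
    (h1 : ∀ i, i ≠ i0 → ∀ x, ‖fderiv ℝ (f i) x‖ ≤ N i * b) :
    |∫ x, jd f x * ψ x| ≤
      (n.factorial : ℝ) * (a * b ^ (n - 1)) * (∏ i, N i) * ∫ x, ‖fderiv ℝ ψ x‖ := by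
  rw [jd_ibp f hf ψ hψ hc i0, abs_neg, ← integral_const_mul]
  have hInt0 : Integrable (fun x => ‖fderiv ℝ ψ x‖) :=
    ((hψ.continuous_fderiv (by norm_num)).norm).integrable_of_hasCompactSupport
      ((hc.fderiv (𝕜 := ℝ)).comp_left (g := fun z => ‖z‖) norm_zero)
  rw [← Real.norm_eq_abs]
  refine norm_integral_le_of_norm_le (hInt0.const_mul _) (Eventually.of_forall fun x => ?_)
  rw [Real.norm_eq_abs, abs_mul]
  have hj := jd_abs_le (Function.update f i0 ψ) x
  rw [← Finset.mul_prod_erase _ _ (Finset.mem_univ i0), Function.update_self] at hj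
  have hp : ∏ i ∈ Finset.univ.erase i0, ‖fderiv ℝ (Function.update f i0 ψ i) x‖ ≤
      ∏ i ∈ Finset.univ.erase i0, (N i * b) := by
    refine Finset.prod_le_prod (fun _ _ => norm_nonneg _) fun i hi => ?_
    rw [Function.update_of_ne (Finset.ne_of_mem_erase hi)]
    exact h1 i (Finset.ne_of_mem_erase hi) x
  rw [Finset.prod_mul_distrib, Finset.prod_const, Finset.card_erase_of_mem (Finset.mem_univ i0),
    Finset.card_univ, Fintype.card_fin] at hp
  rw [← Finset.mul_prod_erase _ N (Finset.mem_univ i0)]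
  have hPn : 0 ≤ ∏ i ∈ Finset.univ.erase i0, N i := Finset.prod_nonneg fun i _ => hN i
  by_cases hx : x ∈ tsupport ψ
  · calc |f i0 x| * |jd (Function.update f i0 ψ) x|
        ≤ (N i0 * a) * ((n.factorial : ℝ) * (‖fderiv ℝ ψ x‖ *
          ((∏ i ∈ Finset.univ.erase i0, N i) * b ^ (n - 1)))) := by
          refine mul_le_mul (h0 x hx) (hj.trans ?_) (abs_nonneg _) (mul_nonneg (hN _) ha)
          gcongr
      _ = _ := by ring
  · have h00 : fderiv ℝ ψ x = 0 := by
      have : x ∉ tsupport (fderiv ℝ ψ) := fun h => hx (tsupport_fderiv_subset ℝ h)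
      exact image_eq_zero_of_notMem_tsupport this
    have : jd (Function.update f i0 ψ) x = 0 := by
      rw [h00, norm_zero, zero_mul, mul_zero] at hj
      exact abs_nonpos_iff.1 hj
    rw [this, h00]; simp

/-- A fixed bump function. -/
def bmp (n : ℕ) : ContDiffBump (0 : Euc n) := ⟨1 / 2, 1, by norm_num, by norm_num⟩

/-- The standard mollifier. -/
def rho (n : ℕ) : Euc n → ℝ := (bmp n).normed volume

lemma rho_nonneg (n : ℕ) (x : Euc n) : 0 ≤ rho n x := (bmp n).nonneg_normed x

lemma rho_contDiff (n : ℕ) : ContDiff ℝ 2 (rho n) := 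
  ContDiffBump.contDiff_normed (n := (2 : ℕ∞)) (bmp n)

lemma rho_supp (n : ℕ) : HasCompactSupport (rho n) := (bmp n).hasCompactSupport_normed

lemma rho_tsupp (n : ℕ) : tsupport (rho n) = closedBall 0 1 := (bmp n).tsupport_normed_eq

lemma rho_int (n : ℕ) : ∫ x, rho n x = 1 := (bmp n).integral_normed

lemma rho_integrable (n : ℕ) : Integrable (rho n) :=
  (rho_contDiff n).continuous.integrable_of_hasCompactSupport (rho_supp n)

/-- Mollification at scale `t`. -/
def mol {n : ℕ} (t : ℝ) (f : Euc n → ℝ) (x : Euc n) : ℝ := ∫ y, rho n y * f (x - t • y)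

lemma mol_integrable {n : ℕ} {h : Euc n → ℝ} (hh : Continuous h) :
    Integrable (fun y => rho n y * h y) :=
  ((rho_contDiff n).continuous.mul hh).integrable_of_hasCompactSupport (rho_supp n).mul_right

lemma rho_avg {n : ℕ} {h : Euc n → ℝ} {B : ℝ}
    (hB : ∀ y, ‖y‖ ≤ 1 → |h y| ≤ B) : |∫ y, rho n y * h y| ≤ B := by
  have h1 : ∫ y, rho n y * B = B := by
    rw [integral_mul_const, rho_int, one_mul]
  rw [← h1, ← Real.norm_eq_abs]
  refine norm_integral_le_of_norm_le ((rho_integrable n).mul_const B)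
    (Eventually.of_forall fun y => ?_)
  rw [Real.norm_eq_abs, abs_mul, abs_of_nonneg (rho_nonneg n y)]
  by_cases hy : ‖y‖ ≤ 1
  · exact mul_le_mul_of_nonneg_left (hB y hy) (rho_nonneg n y)
  · have : rho n y = 0 := by
      apply image_eq_zero_of_notMem_tsupport
      rw [rho_tsupp]
      simpa using hy
    simp [this]

lemma mol_eq_conv {n : ℕ} {t : ℝ} (ht : t ≠ 0) (f : Euc n → ℝ) (x : Euc n) :
    mol t f x = (convolution (rho n) (fun z => f (t • z)) (ContinuousLinearMap.mul ℝ ℝ) volume)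
      (t⁻¹ • x) := by
  rw [convolution_def]
  unfold mol
  congr 1
  ext y
  simp [smul_sub, smul_smul, ht]

lemma mol_contDiff {n : ℕ} {t : ℝ} (ht : t ≠ 0) {f : Euc n → ℝ} (hf : Continuous f) :
    ContDiff ℝ 2 (mol t f) := by
  have h1 : ContDiff ℝ 2 (convolution (rho n) (fun z => f (t • z)) (ContinuousLinearMap.mul ℝ ℝ)
      volume) := by
    refine HasCompactSupport.contDiff_convolution_left (n := (2 : ℕ∞)) _ (rho_supp n)
      (rho_contDiff n) ?_
    exact (hf.comp (continuous_const_smul t)).locallyIntegrable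
  have : mol t f = fun x => (convolution (rho n) (fun z => f (t • z))
      (ContinuousLinearMap.mul ℝ ℝ) volume) (t⁻¹ • x) := funext fun x => mol_eq_conv ht f x
  rw [this]
  exact h1.comp (contDiff_const_smul _)

lemma mol_comp_cont {n : ℕ} {f : Euc n → ℝ} (hf : Continuous f) (t : ℝ) (x : Euc n) :
    Continuous (fun y => f (x - t • y)) := by fun_prop

lemma mol_sub_const {n : ℕ} {t : ℝ} {f : Euc n → ℝ} (hf : Continuous f) (x : Euc n) (c : ℝ) :
    mol t f x - c = ∫ y, rho n y * (f (x - t • y) - c) := by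
  have : c = ∫ y, rho n y * c := by rw [integral_mul_const, rho_int, one_mul]
  conv_lhs => rw [this]
  unfold mol
  rw [← integral_sub (mol_integrable (mol_comp_cont hf t x)) ((rho_integrable n).mul_const c)]
  congr 1
  ext y
  ring

/-- Constant in the gradient bound. -/
def gradC (n : ℕ) : ℝ := ∫ y, ‖fderiv ℝ (rho n) y‖

lemma gradC_nonneg (n : ℕ) : 0 ≤ gradC n := integral_nonneg fun _ => norm_nonneg _

lemma mol_close {n : ℕ} {t H α : ℝ} (ht : 0 < t) (hH : 0 ≤ H) (hα : 0 < α) {f : Euc n → ℝ}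
    (hf : Continuous f) (hh : ∀ x y, |f x - f y| ≤ H * dist x y ^ α) (x : Euc n) :
    |mol t f x - f x| ≤ H * t ^ α := by
  rw [mol_sub_const hf]
  refine rho_avg fun y hy => (hh _ _).trans ?_
  refine mul_le_mul_of_nonneg_left ?_ hH
  refine Real.rpow_le_rpow dist_nonneg ?_ hα.le
  rw [dist_eq_norm]
  simp only [sub_sub_cancel_left, norm_neg, norm_smul, Real.norm_eq_abs, abs_of_pos ht]
  nlinarith

lemma mol_grad {n : ℕ} {t H α : ℝ} (ht : 0 < t) (hH : 0 ≤ H) (hα : 0 < α) {f : Euc n → ℝ}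
    (hf : Continuous f) (hh : ∀ x y, |f x - f y| ≤ H * dist x y ^ α) (x : Euc n) :
    ‖fderiv ℝ (mol t f) x‖ ≤ gradC n * (H * t ^ α) * t⁻¹ := by
  set c := f x with hc
  set h : Euc n → ℝ := fun z => f (t • z) - c with hhdef
  have hcont : Continuous h := by fun_prop
  have hm : mol t f = fun z => (convolution (rho n) h (ContinuousLinearMap.mul ℝ ℝ)
      volume) (t⁻¹ • z) + c := by
    ext z
    have := mol_sub_const (t := t) hf z c
    rw [sub_eq_iff_eq_add] at this
    rw [this]
    congr 1
    rw [convolution_def]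
    congr 1
    ext y
    simp [hhdef, smul_sub, smul_smul, ht.ne']
  have hd := HasCompactSupport.hasFDerivAt_convolution_left (ContinuousLinearMap.mul ℝ ℝ)
    (μ := volume) (rho_supp n) ((rho_contDiff n).of_le (by norm_num)) hcont.locallyIntegrable
    (t⁻¹ • x)
  set D := (convolution (fderiv ℝ (rho n)) h
    (ContinuousLinearMap.precompL (Euc n) (ContinuousLinearMap.mul ℝ ℝ)) volume (t⁻¹ • x)) with hD
  have hDn : ‖D‖ ≤ gradC n * (H * t ^ α) := by
    rw [hD, convolution_def, gradC, ← integral_mul_const]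
    have hInt0 : Integrable (fun x => ‖fderiv ℝ (rho n) x‖) :=
      (((rho_contDiff n).continuous_fderiv (by norm_num)).norm).integrable_of_hasCompactSupport
      ((rho_supp n).fderiv (𝕜 := ℝ)).norm
    refine norm_integral_le_of_norm_le (hInt0.mul_const _) (Eventually.of_forall fun y => ?_)
    have e1 : ‖(ContinuousLinearMap.precompL (Euc n) (ContinuousLinearMap.mul ℝ ℝ))
        (fderiv ℝ (rho n) y) (h (t⁻¹ • x - y))‖ ≤ ‖fderiv ℝ (rho n) y‖ * |h (t⁻¹ • x - y)| := by
      refine ContinuousLinearMap.opNorm_le_bound _ (by positivity) fun v => ?_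
      rw [ContinuousLinearMap.precompL_apply]
      simp only [ContinuousLinearMap.mul_apply', norm_mul]
      have := (fderiv ℝ (rho n) y).le_opNorm v
      rw [Real.norm_eq_abs (h _)]
      nlinarith [abs_nonneg (h (t⁻¹ • x - y))]
    refine e1.trans ?_
    by_cases hy : ‖y‖ ≤ 1
    · refine mul_le_mul_of_nonneg_left ?_ (norm_nonneg _)
      refine (hh _ _).trans ?_
      refine mul_le_mul_of_nonneg_left ?_ hH
      refine Real.rpow_le_rpow dist_nonneg ?_ hα.le
      rw [dist_eq_norm]
      simp only [smul_sub, smul_smul, mul_inv_cancel₀ ht.ne', one_smul]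
      simp only [sub_sub_cancel_left, norm_neg, norm_smul, Real.norm_eq_abs, abs_of_pos ht]
      nlinarith
    · have : fderiv ℝ (rho n) y = 0 := by
        apply image_eq_zero_of_notMem_tsupport
        intro h
        have := tsupport_fderiv_subset ℝ h
        rw [rho_tsupp] at this
        exact hy (by simpa using this)
      simp [this]
  have hcomp : HasFDerivAt (mol t f) (D.comp (t⁻¹ • ContinuousLinearMap.id ℝ (Euc n))) x := by
    rw [hm]
    exact (HasFDerivAt.comp x hd ((hasFDerivAt_id x).const_smul t⁻¹)).add_const c
  rw [hcomp.fderiv]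
  refine (ContinuousLinearMap.opNorm_comp_le _ _).trans ?_
  refine mul_le_mul hDn ?_ (norm_nonneg _) (mul_nonneg (gradC_nonneg n) (by positivity))
  rw [norm_smul, Real.norm_eq_abs, abs_of_pos (inv_pos.2 ht)]
  have := ContinuousLinearMap.norm_id_le (𝕜 := ℝ) (E := Euc n)
  have := inv_pos.2 ht
  nlinarith

lemma mol_fderiv_close {n : ℕ} {f : Euc n → ℝ} (hf : Continuous f) {A : Euc n →L[ℝ] ℝ}
    {x0 : Euc n} (hA : HasStrictFDerivAt f A x0) {ε : ℝ} (hε : 0 < ε) :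
    ∃ δ > 0, ∀ t, 0 < t → t < δ → ∀ x ∈ ball x0 δ, ‖fderiv ℝ (mol t f) x - A‖ ≤ ε := by
  have h1 := hA.isLittleO.def hε
  obtain ⟨δ, hδ, h2⟩ := Metric.eventually_nhds_iff_ball.1 h1
  refine ⟨δ / 2, by positivity, fun t ht htd x hx => ?_⟩
  have hcl : ∀ z ∈ ball x0 (δ / 2), ∀ w : Euc n, ‖w‖ ≤ 1 → z - t • w ∈ ball x0 δ := by
    intro z hz w hw
    rw [mem_ball, dist_eq_norm] at hz ⊢
    calc ‖z - t • w - x0‖ = ‖(z - x0) - t • w‖ := by congr 1; abel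
      _ ≤ ‖z - x0‖ + ‖t • w‖ := norm_sub_le _ _
      _ < δ := by
        rw [norm_smul, Real.norm_eq_abs, abs_of_pos ht]
        nlinarith
  have hdm : HasFDerivAt (mol t f) (fderiv ℝ (mol t f) x) x :=
    ((mol_contDiff ht.ne' hf).differentiable (by norm_num) x).hasFDerivAt
  refine (hdm.sub A.hasFDerivAt).le_of_lip' hε.le ?_
  filter_upwards [isOpen_ball.mem_nhds hx] with z hz
  have e : (mol t f z - A z) - (mol t f x - A x) =
      ∫ w, rho n w * (f (z - t • w) - (f (x - t • w) + A (z - x))) := by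
    have : (mol t f z - A z) - (mol t f x - A x) = mol t f z - (mol t f x + A (z - x)) := by
      rw [map_sub]; ring
    rw [this]
    have e2 : mol t f x + A (z - x) = ∫ w, rho n w * (f (x - t • w) + A (z - x)) := by
      have := mol_sub_const (t := t) hf x (-A (z - x))
      simpa only [sub_neg_eq_add] using this
    rw [e2]
    unfold mol
    rw [← integral_sub (mol_integrable (mol_comp_cont hf t z))
      (mol_integrable (h := fun w => f (x - t • w) + A (z - x)) (by fun_prop))]
    congr 1
    ext w
    ring
  simp only [Pi.sub_apply]
  rw [e, Real.norm_eq_abs]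
  refine rho_avg fun w hw => ?_
  have := h2 (z - t • w, x - t • w) (by
    rw [← ball_prod_same]
    exact ⟨hcl z hz w hw, hcl x hx w hw⟩)
  simp only [sub_sub_sub_cancel_right, Real.norm_eq_abs] at this
  rw [← sub_sub]
  exact this

lemma mol_fderiv_bdd {n : ℕ} {f : Euc n → ℝ} (hf : Continuous f) {K : Set (Euc n)}
    (hK : IsCompact K) (hA : ∀ x ∈ K, ContDiffAt ℝ 1 f x) :
    ∃ B, ∃ δ > 0, ∀ t, 0 < t → t < δ → ∀ x ∈ K, ‖fderiv ℝ (mol t f) x‖ ≤ B := by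
  refine hK.induction_on (p := fun S => ∃ B, ∃ δ > 0, ∀ t, 0 < t → t < δ → ∀ x ∈ S,
    ‖fderiv ℝ (mol t f) x‖ ≤ B) ⟨0, 1, one_pos, by simp⟩ ?_ ?_ ?_
  · rintro s t hst ⟨B, δ, hδ, h⟩
    exact ⟨B, δ, hδ, fun r h1 h2 x hx => h r h1 h2 x (hst hx)⟩
  · rintro s t ⟨B, δ, hδ, h⟩ ⟨B', δ', hδ', h'⟩
    refine ⟨max B B', min δ δ', lt_min hδ hδ', fun r h1 h2 x hx => ?_⟩
    rcases hx with hx | hx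
    · exact (h r h1 (h2.trans_le (min_le_left _ _)) x hx).trans (le_max_left _ _)
    · exact (h' r h1 (h2.trans_le (min_le_right _ _)) x hx).trans (le_max_right _ _)
  · intro x hx
    obtain ⟨δ, hδ, h⟩ := mol_fderiv_close hf ((hA x hx).hasStrictFDerivAt (by norm_num)) one_pos
    refine ⟨ball x δ, mem_nhdsWithin_of_mem_nhds (ball_mem_nhds x hδ), ‖fderiv ℝ f x‖ + 1, δ, hδ,
      fun t h1 h2 z hz => ?_⟩
    have h3 := h t h1 h2 z hz
    have h4 := norm_sub_norm_le (fderiv ℝ (mol t f) z) (fderiv ℝ f x)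
    linarith

lemma telesc {n : ℕ} {X : Type*} (Φ : (Fin n → X) → ℝ) (a b : Fin n → X) (B : ℝ)
    (H : ∀ h : Fin n → X, (∀ i, h i = a i ∨ h i = b i) → ∀ j,
      |Φ (Function.update h j (a j)) - Φ (Function.update h j (b j))| ≤ B) :
    |Φ a - Φ b| ≤ n * B := by
  have main : ∀ s : Finset (Fin n), |Φ (s.piecewise a b) - Φ b| ≤ s.card * B := by
    intro s
    induction s using Finset.induction_on with
    | empty => simp
    | insert j s hj ih =>
      rw [Finset.piecewise_insert, Finset.card_insert_of_notMem hj]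
      have h1 := H (s.piecewise a b) (fun i => by
        by_cases hi : i ∈ s
        · left; simp [hi]
        · right; simp [hi]) j
      have h2 : Function.update (s.piecewise a b) j (b j) = s.piecewise a b := by
        rw [Function.update_eq_self_iff]; simp [hj]
      rw [h2] at h1
      push_cast
      have := abs_sub_le (Φ (Function.update (s.piecewise a b) j (a j))) (Φ (s.piecewise a b)) (Φ b)
      linarith
  have := main Finset.univ
  simpa using this

lemma jd_update_sub {n : ℕ} (h : Fin n → Euc n → ℝ) (j : Fin n) (a b : Euc n → ℝ) (x : Euc n)
    (ha : DifferentiableAt ℝ a x) (hb : DifferentiableAt ℝ b x) :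
    jd (Function.update h j (a - b)) x =
      jd (Function.update h j a) x - jd (Function.update h j b) x := by
  rw [jd_split, jd_split, jd_split, ← Finset.sum_sub_distrib]
  refine Finset.sum_congr rfl fun σ _ => ?_
  rw [fderiv_sub ha hb]
  simp only [sub_apply]
  ring

lemma jd_continuous {n : ℕ} {f : Fin n → Euc n → ℝ} (hf : ∀ i, ContDiff ℝ 2 (f i)) :
    Continuous (jd f) := by
  unfold jd
  refine continuous_finsetSum _ fun σ _ => continuous_const.mul ?_
  refine continuous_finsetProd _ fun i _ => ?_
  exact ((hf i).continuous_fderiv (by norm_num)).clm_apply continuous_const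

lemma jd_integrable {n : ℕ} {f : Fin n → Euc n → ℝ} (hf : ∀ i, ContDiff ℝ 2 (f i))
    {ψ : Euc n → ℝ} (hψ : ContDiff ℝ 1 ψ) (hc : HasCompactSupport ψ) :
    Integrable (fun x => jd f x * ψ x) :=
  ((jd_continuous hf).mul hψ.continuous).integrable_of_hasCompactSupport hc.mul_left

lemma holder_continuous {n : ℕ} {H α : ℝ} (hα : 0 < α) {f : Euc n → ℝ}
    (hh : ∀ x y, |f x - f y| ≤ H * dist x y ^ α) : Continuous f := by
  rw [continuous_iff_continuousAt]
  intro x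
  rw [ContinuousAt, tendsto_iff_dist_tendsto_zero]
  have h1 : Tendsto (fun y => H * dist y x ^ α) (𝓝 x) (𝓝 0) := by
    have : Continuous (fun y => H * dist y x ^ α) := by
      refine continuous_const.mul ?_
      exact (continuous_id.dist continuous_const).rpow_const fun _ => Or.inr hα.le
    have h2 := this.tendsto x
    simpa [Real.zero_rpow hα.ne'] using h2
  exact squeeze_zero (fun _ => dist_nonneg) (fun y => by rw [Real.dist_eq]; exact hh y x) h1

lemma jd_mol_tendsto {n : ℕ} {f : Fin n → Euc n → ℝ} (hf : ∀ i, Continuous (f i))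
    {ψ : Euc n → ℝ} (hψ : ContDiff ℝ 1 ψ) (hc : HasCompactSupport ψ)
    (hA : ∀ i, ∀ x ∈ tsupport ψ, ContDiffAt ℝ 1 (f i) x) (s : ℕ → ℝ) (hs : ∀ k, 0 < s k)
    (hs0 : Tendsto s atTop (𝓝 0)) :
    Tendsto (fun k => ∫ x, jd (fun i => mol (s k) (f i)) x * ψ x) atTop
      (𝓝 (∫ x, jd f x * ψ x)) := by
  choose B δ hδ hB using fun i => mol_fderiv_bdd (hf i) hc (hA i)
  have hev : ∀ᶠ k in atTop, ∀ i, s k < δ i := by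
    rw [eventually_all]
    exact fun i => hs0.eventually_lt_const (hδ i)
  refine tendsto_integral_filter_of_dominated_convergence
    (fun x => (n.factorial : ℝ) * (∏ i, B i) * |ψ x|) ?_ ?_ ?_ ?_
  · refine Eventually.of_forall fun k => ?_
    exact (jd_integrable (fun i => mol_contDiff (hs k).ne' (hf i)) hψ hc).aestronglyMeasurable
  · filter_upwards [hev] with k hk
    refine Eventually.of_forall fun x => ?_
    rw [Real.norm_eq_abs, abs_mul]
    by_cases hx : x ∈ tsupport ψ
    · refine mul_le_mul_of_nonneg_right ((jd_abs_le _ x).trans ?_) (abs_nonneg _)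
      refine mul_le_mul_of_nonneg_left ?_ (by positivity)
      exact Finset.prod_le_prod (fun _ _ => norm_nonneg _) fun i _ => hB i _ (hs k) (hk i) x hx
    · rw [image_eq_zero_of_notMem_tsupport hx]; simp
  · refine Integrable.const_mul ?_ _
    exact (hψ.continuous.integrable_of_hasCompactSupport hc).abs
  · refine Eventually.of_forall fun x => ?_
    by_cases hx : x ∈ tsupport ψ
    · refine Tendsto.mul_const _ ?_
      unfold jd
      refine tendsto_finsetSum _ fun σ _ => Tendsto.const_mul _ ?_
      refine tendsto_finsetProd _ fun i _ => ?_
      have : Tendsto (fun k => fderiv ℝ (mol (s k) (f i)) x) atTop (𝓝 (fderiv ℝ (f i) x)) := by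
        rw [Metric.tendsto_nhds]
        intro ε hε
        obtain ⟨d, hd, h⟩ := mol_fderiv_close (hf i)
          ((hA i x hx).hasStrictFDerivAt (by norm_num)) (half_pos hε)
        filter_upwards [hs0.eventually_lt_const hd] with k hk
        rw [dist_eq_norm]
        exact (h _ (hs k) hk x (mem_ball_self hd)).trans_lt (half_lt_self hε)
      exact ((ContinuousLinearMap.apply ℝ ℝ
        (EuclideanSpace.single (σ i) (1:ℝ) : Euc n)).continuous.tendsto _).comp this
    · rw [image_eq_zero_of_notMem_tsupport hx]; simp

/-- Multilinear estimate for global Hölder functions. -/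
lemma jd_key (n : ℕ) (hn : 1 ≤ n) (α : ℝ) (hα0 : 0 < α) (hα : ((n : ℝ) - 1) < n * α)
    (hα₂ : α < 1) :
    ∃ C : ℝ, 0 < C ∧ ∀ (f : Fin n → Euc n → ℝ) (N : Fin n → ℝ) (ψ : Euc n → ℝ),
      (∀ i, 0 ≤ N i) → ContDiff ℝ 1 ψ → HasCompactSupport ψ →
      (∀ i x y, |f i x - f i y| ≤ N i * dist x y ^ α) →
      (∀ i, ∀ x ∈ tsupport ψ, |f i x| ≤ N i) →
      (∀ i, ∀ x ∈ tsupport ψ, ContDiffAt ℝ 1 (f i) x) →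
      |∫ x, jd f x * ψ x| ≤ C * (∏ i, N i) * ∫ x, ‖fderiv ℝ ψ x‖ := by
  set c := gradC n with hcdef
  have hc0 : 0 ≤ c := gradC_nonneg n
  set β : ℝ := n * α - (n - 1) with hβ
  have hβ0 : 0 < β := by rw [hβ]; linarith
  set r : ℝ := (1 / 2 : ℝ) ^ β with hr
  have hr0 : 0 < r := by positivity
  have hr1 : r < 1 := Real.rpow_lt_one (by norm_num) (by norm_num) hβ0
  set A0 : ℝ := (n.factorial : ℝ) * (2 * c ^ (n - 1)) with hA0
  set A1 : ℝ := n * ((n.factorial : ℝ) * (2 * (2 * c) ^ (n - 1))) with hA1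
  have hA0n : 0 ≤ A0 := by positivity
  have hA1n : 0 ≤ A1 := by positivity
  refine ⟨A0 + A1 * (1 - r)⁻¹ + 1, by
    have : 0 < (1 - r)⁻¹ := inv_pos.2 (by linarith)
    positivity, ?_⟩
  intro f N ψ hN hψ hcs hh hM hC
  set I := ∫ x, ‖fderiv ℝ ψ x‖ with hI
  have hI0 : 0 ≤ I := integral_nonneg fun _ => norm_nonneg _
  have hP0 : 0 ≤ ∏ i, N i := Finset.prod_nonneg fun i _ => hN i
  have hfc : ∀ i, Continuous (f i) := fun i => holder_continuous hα0 (hh i)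
  set s : ℕ → ℝ := fun k => (1 / 2 : ℝ) ^ k with hs
  have hs0 : ∀ k, 0 < s k := fun k => by positivity
  have hst : Tendsto s atTop (𝓝 0) := tendsto_pow_atTop_nhds_zero_of_lt_one (by norm_num)
    (by norm_num)
  set F : ℕ → Fin n → Euc n → ℝ := fun k i => mol (s k) (f i) with hF
  have hFd : ∀ k i, ContDiff ℝ 2 (F k i) := fun k i => mol_contDiff (hs0 k).ne' (hfc i)
  set T : (Fin n → Euc n → ℝ) → ℝ := fun g => ∫ x, jd g x * ψ x with hT
  have hclose : ∀ k i x, |F k i x - f i x| ≤ N i * s k ^ α := fun k i x =>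
    mol_close (hs0 k) (hN i) hα0 (hfc i) (hh i) x
  have hgrad : ∀ k i x, ‖fderiv ℝ (F k i) x‖ ≤ N i * (c * (s k ^ α * (s k)⁻¹)) := fun k i x =>
    (mol_grad (hs0 k) (hN i) hα0 (hfc i) (hh i) x).trans_eq (by ring)
  have hT0 : |T (F 0)| ≤ A0 * (∏ i, N i) * I := by
    have := jd_est (F 0) (hFd 0) ψ hψ hcs ⟨0, hn⟩ N 2 c hN (by norm_num) hc0 ?_ ?_
    · exact this
    · intro x hx
      have h1 := hclose 0 ⟨0, hn⟩ x
      have h2 := hM ⟨0, hn⟩ x hx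
      simp only [hs, pow_zero, Real.one_rpow, mul_one] at h1
      have h3 := abs_sub_abs_le_abs_sub (F 0 ⟨0, hn⟩ x) (f ⟨0, hn⟩ x)
      linarith
    · intro i _ x
      have := hgrad 0 i x
      simpa [hs] using this
  have hstep : ∀ k, |T (F (k + 1)) - T (F k)| ≤ A1 * (∏ i, N i) * I * r ^ k := by
    intro k
    have hsα : s (k + 1) ^ α ≤ s k ^ α := by
      refine Real.rpow_le_rpow (hs0 _).le ?_ hα0.le
      simp only [hs, pow_succ]
      have := hs0 k
      simp only [hs] at this
      linarith
    have hsi : (s (k + 1))⁻¹ = 2 * (s k)⁻¹ := by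
      simp only [hs, pow_succ, mul_inv]; norm_num; ring
    have hka : 0 ≤ s k ^ α := (Real.rpow_pos_of_pos (hs0 k) _).le
    have hki : 0 < (s k)⁻¹ := inv_pos.2 (hs0 k)
    set b : ℝ := 2 * c * (s k ^ α * (s k)⁻¹) with hb
    have hb0 : 0 ≤ b := by positivity
    have htel := telesc T (F (k + 1)) (F k)
      ((n.factorial : ℝ) * ((2 * s k ^ α) * b ^ (n - 1)) * (∏ i, N i) * I) ?_
    · refine htel.trans_eq ?_
      have hpw : (s k ^ α) * (s k ^ α * (s k)⁻¹) ^ (n - 1) = r ^ k := by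
        have e1 : s k ^ α * (s k)⁻¹ = s k ^ (α - 1) := by
          rw [Real.rpow_sub (hs0 k), Real.rpow_one, div_eq_mul_inv]
        rw [e1, ← Real.rpow_natCast (s k ^ (α - 1)), ← Real.rpow_mul (hs0 k).le,
          ← Real.rpow_add (hs0 k), Nat.cast_sub hn]
        have e2 : α + (α - 1) * ((n : ℝ) - (1 : ℕ)) = β := by
          rw [hβ]; push_cast; ring
        rw [e2, hr]
        simp only [hs]
        rw [← Real.rpow_natCast, ← Real.rpow_natCast, ← Real.rpow_mul (by norm_num),
          ← Real.rpow_mul (by norm_num), mul_comm]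
      rw [← hpw, hA1, hb, mul_pow (2 * c)]
      ring
    · intro h hh' j
      have hhd : ∀ i, ContDiff ℝ 2 (h i) := by
        intro i
        rcases hh' i with e | e <;> rw [e]
        · exact hFd _ _
        · exact hFd _ _
      have hud : ∀ g : Euc n → ℝ, ContDiff ℝ 2 g → ∀ i, ContDiff ℝ 2 (Function.update h j g i) := by
        intro g hg i
        by_cases hij : i = j
        · subst hij; simpa using hg
        · simpa [Function.update_of_ne hij] using hhd i
      have hlin : T (Function.update h j (F (k + 1) j)) - T (Function.update h j (F k j)) =
          T (Function.update h j (F (k + 1) j - F k j)) := by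
        simp only [hT]
        rw [← integral_sub (jd_integrable (hud _ (hFd _ _)) hψ hcs)
          (jd_integrable (hud _ (hFd _ _)) hψ hcs)]
        congr 1
        ext x
        rw [jd_update_sub _ _ _ _ _ ((hFd _ _).differentiable (by norm_num) x)
          ((hFd _ _).differentiable (by norm_num) x)]
        ring
      rw [hlin]
      refine jd_est _ (hud _ ((hFd _ _).sub (hFd _ _))) ψ hψ hcs j N _ b hN (by positivity) hb0
        ?_ ?_
      · intro x _
        rw [Function.update_self]
        have h1 := hclose (k + 1) j x
        have h2 := hclose k j x
        have h3 := abs_sub_le (F (k + 1) j x) (f j x) (F k j x)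
        rw [abs_sub_comm (f j x)] at h3
        have h4 := mul_le_mul_of_nonneg_left hsα (hN j)
        linarith
      · intro i hij x
        rw [Function.update_of_ne hij]
        rcases hh' i with e | e <;> rw [e]
        · refine (hgrad (k + 1) i x).trans ?_
          refine mul_le_mul_of_nonneg_left ?_ (hN i)
          rw [hsi, hb]
          have : s (k + 1) ^ α * (2 * (s k)⁻¹) ≤ s k ^ α * (2 * (s k)⁻¹) := by gcongr
          nlinarith
        · refine (hgrad k i x).trans ?_
          refine mul_le_mul_of_nonneg_left ?_ (hN i)
          rw [hb]
          have : 0 ≤ c * (s k ^ α * (s k)⁻¹) := by positivity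
          linarith
  have hall : ∀ k, |T (F k)| ≤ (A0 + A1 * (1 - r)⁻¹ + 1) * (∏ i, N i) * I := by
    intro k
    have h1 : T (F k) = T (F 0) + ∑ j ∈ Finset.range k, (T (F (j + 1)) - T (F j)) := by
      rw [Finset.sum_range_sub (fun j => T (F j))]; ring
    have h2 : |∑ j ∈ Finset.range k, (T (F (j + 1)) - T (F j))| ≤
        A1 * (∏ i, N i) * I * (1 - r)⁻¹ := by
      refine (Finset.abs_sum_le_sum_abs _ _).trans ?_
      refine (Finset.sum_le_sum fun j _ => hstep j).trans ?_
      rw [← Finset.mul_sum]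
      refine mul_le_mul_of_nonneg_left ?_ (by positivity)
      rw [← tsum_geometric_of_lt_one hr0.le hr1]
      exact (summable_geometric_of_lt_one hr0.le hr1).sum_le_tsum _ fun _ _ => by positivity
    rw [h1]
    refine (abs_add_le _ _).trans ?_
    have h3 : 0 ≤ (∏ i, N i) * I := by positivity
    nlinarith
  have hlim := jd_mol_tendsto hfc hψ hcs hC s hs0 hst
  exact le_of_tendsto hlim.abs (Eventually.of_forall hall)

lemma dist_rpow_triangle {n : ℕ} {α : ℝ} (hα : 0 < α) (hα1 : α < 1) (x y z : Euc n) :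
    dist x z ^ α ≤ dist x y ^ α + dist y z ^ α :=
  (Real.rpow_le_rpow dist_nonneg (dist_triangle x y z) hα.le).trans
    (Real.rpow_add_le_add_rpow dist_nonneg dist_nonneg hα.le hα1.le)

/-- McShane extension of Hölder functions. -/
lemma holder_ext {n : ℕ} {α H : ℝ} (hα : 0 < α) (hα1 : α < 1) (hH : 0 ≤ H) (Ω : Set (Euc n))
    (f : Euc n → ℝ) (hf : ∀ x ∈ Ω, ∀ y ∈ Ω, |f x - f y| ≤ H * dist x y ^ α) :
    ∃ g : Euc n → ℝ, (∀ x ∈ Ω, g x = f x) ∧ ∀ x y, |g x - g y| ≤ H * dist x y ^ α := by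
  rcases Ω.eq_empty_or_nonempty with rfl | ⟨y0, hy0⟩
  · refine ⟨fun _ => 0, by simp, fun x y => ?_⟩
    simp only [sub_self, abs_zero]
    positivity
  have : Nonempty Ω := ⟨⟨y0, hy0⟩⟩
  have hbdd : ∀ x : Euc n, BddBelow (Set.range fun y : Ω => f y + H * dist x (y : Euc n) ^ α) := by
    intro x
    refine ⟨f y0 - H * dist x y0 ^ α, ?_⟩
    rintro _ ⟨y, rfl⟩
    have h1 := (abs_le.1 (hf y0 hy0 y y.2)).2
    have h2 := mul_le_mul_of_nonneg_left (dist_rpow_triangle hα hα1 y0 x y) hH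
    rw [dist_comm y0 x] at h2
    simp only
    linarith
  set g : Euc n → ℝ := fun x => ⨅ y : Ω, (f y + H * dist x (y : Euc n) ^ α) with hg
  have hone : ∀ x y, g x ≤ g y + H * dist x y ^ α := by
    intro x y
    rw [← sub_le_iff_le_add]
    refine le_ciInf fun z => ?_
    have h1 : g x ≤ f z + H * dist x z ^ α := ciInf_le (hbdd x) z
    have h2 := mul_le_mul_of_nonneg_left (dist_rpow_triangle hα hα1 x y z) hH
    linarith
  refine ⟨g, fun x hx => le_antisymm ?_ ?_, fun x y => ?_⟩
  · have := ciInf_le (hbdd x) ⟨x, hx⟩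
    simpa [Real.zero_rpow hα.ne'] using this
  · refine le_ciInf fun z => ?_
    have := (abs_le.1 (hf x hx z z.2)).2
    linarith
  · rw [abs_le]
    have h1 := hone x y
    have h2 := hone y x
    rw [dist_comm y x] at h2
    constructor <;> linarith

lemma local_paths {n : ℕ} {Ω : Set (Euc n)} (hΩo : IsOpen Ω) (hΩs : SmoothBoundary n Ω)
    (x0 : Euc n) (hx0 : x0 ∈ closure Ω) (R : ℝ) (hR : 0 < R) :
    ∃ r > 0, ∃ M : ℝ, ∀ x ∈ Ω ∩ ball x0 r, ∀ y ∈ Ω ∩ ball x0 r, ∃ p q,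
      segment ℝ x p ⊆ Ω ∩ ball x0 R ∧ segment ℝ p q ⊆ Ω ∩ ball x0 R ∧
      segment ℝ q y ⊆ Ω ∩ ball x0 R ∧ ‖p - x‖ + ‖q - p‖ + ‖y - q‖ ≤ M * ‖x - y‖ := by
  by_cases hxΩ : x0 ∈ Ω
  · obtain ⟨r, hr, hrs⟩ := Metric.isOpen_iff.1 (hΩo.inter isOpen_ball) x0
      ⟨hxΩ, mem_ball_self hR⟩
    refine ⟨r, hr, 1, fun x hx y hy => ⟨x, y, ?_, ?_, ?_, ?_⟩⟩
    · rw [segment_same]; exact Set.singleton_subset_iff.2 (hrs hx.2)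
    · exact ((convex_ball x0 r).segment_subset hx.2 hy.2).trans hrs
    · rw [segment_same]; exact Set.singleton_subset_iff.2 (hrs hy.2)
    · simp [norm_sub_rev]
  · obtain ⟨f, hf, hΩf, hfr⟩ := hΩs
    have hne : fderiv ℝ f x0 ≠ 0 := hfr x0 ⟨hx0, by rwa [hΩo.interior_eq]⟩
    set D := fderiv ℝ f x0 with hD
    obtain ⟨v, hv⟩ : ∃ v, D v ≠ 0 := by
      by_contra hcon
      push Not at hcon
      exact hne (ContinuousLinearMap.ext hcon)
    set e : Euc n := -((D v)⁻¹ • v) with he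
    have hDe : D e = -1 := by simp [he, hv]
    set ε : ℝ := 1 / (2 * (‖e‖ + 1)) with hε
    have hε0 : 0 < ε := by positivity
    have hεe : ε * ‖e‖ ≤ 1 / 2 := by
      rw [hε, div_mul_eq_mul_div, div_le_div_iff₀ (by positivity) (by norm_num)]
      linarith
    have hε1 : ε ≤ 1 := by
      rw [hε, div_le_one (by positivity)]
      linarith [norm_nonneg e]
    have hstr : HasStrictFDerivAt f D x0 := hf.contDiffAt.hasStrictFDerivAt (by simp)
    obtain ⟨δ1, hδ1, h1⟩ := Metric.eventually_nhds_iff_ball.1 (hstr.isLittleO.def hε0)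
    set δ := min δ1 R with hδdef
    have hδ : 0 < δ := lt_min hδ1 hR
    have h2 : ∀ p ∈ ball x0 δ, ∀ q ∈ ball x0 δ, |f p - f q - D (p - q)| ≤ ε * ‖p - q‖ := by
      intro p hp q hq
      refine h1 (p, q) ?_
      rw [← ball_prod_same]
      exact ⟨ball_subset_ball (min_le_left _ _) hp, ball_subset_ball (min_le_left _ _) hq⟩
    set L := ‖D‖ + 1 with hL
    have hL0 : 0 < L := by positivity
    have hlip : ∀ p ∈ ball x0 δ, ∀ q ∈ ball x0 δ, f p ≤ f q + L * ‖p - q‖ := by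
      intro p hp q hq
      have h3 := (abs_le.1 (h2 p hp q hq)).2
      have h4 := (le_abs_self _).trans (D.le_opNorm (p - q))
      have h5 : ε * ‖p - q‖ ≤ 1 * ‖p - q‖ := by gcongr
      rw [hL]; linarith
    have hdec : ∀ p ∈ ball x0 δ, ∀ s : ℝ, 0 ≤ s → p + s • e ∈ ball x0 δ →
        f (p + s • e) ≤ f p - s / 2 := by
      intro p hp s hs hps
      have h3 := (abs_le.1 (h2 _ hps p hp)).2
      simp only [add_sub_cancel_left, map_smul, hDe, norm_smul, Real.norm_eq_abs,
        abs_of_nonneg hs, smul_eq_mul] at h3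
      nlinarith
    set M0 := 2 * L with hM0
    set r := δ / (1 + 2 * M0 * ‖e‖) with hr
    have hden : 0 < 1 + 2 * M0 * ‖e‖ := by positivity
    have hr0 : 0 < r := by positivity
    have hrδ : r + 2 * r * M0 * ‖e‖ = δ := by
      rw [hr]; field_simp
    have hrle : r ≤ δ := by
      have : 0 ≤ 2 * r * M0 * ‖e‖ := by positivity
      linarith
    refine ⟨r, hr0, 2 * M0 * ‖e‖ + 1, fun x hx y hy => ?_⟩
    set h := ‖x - y‖ with hh
    have hh0 : 0 ≤ h := norm_nonneg _
    have hh2 : h < 2 * r := by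
      have := dist_triangle_right x y x0
      have h3 := mem_ball.1 hx.2
      have h4 := mem_ball.1 hy.2
      rw [hh, ← dist_eq_norm]; linarith
    have hin : ∀ w ∈ ball x0 r, ∀ s : ℝ, 0 ≤ s → s ≤ M0 * h → w + s • e ∈ ball x0 δ := by
      intro w hw s hs hsM
      rw [mem_ball, dist_eq_norm] at hw ⊢
      have e1 : w + s • e - x0 = (w - x0) + s • e := by abel
      rw [e1]
      have e2 := norm_add_le (w - x0) (s • e)
      rw [norm_smul, Real.norm_eq_abs, abs_of_nonneg hs] at e2
      have e3 : s * ‖e‖ ≤ (M0 * (2 * r)) * ‖e‖ := by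
        refine mul_le_mul_of_nonneg_right (hsM.trans ?_) (norm_nonneg _)
        exact mul_le_mul_of_nonneg_left hh2.le (by positivity)
      linarith
    have hball : ∀ w ∈ ball x0 r, w ∈ ball x0 δ := fun w hw => ball_subset_ball hrle hw
    have hRδ : ∀ w ∈ ball x0 δ, w ∈ ball x0 R := fun w hw =>
      ball_subset_ball (min_le_right _ _) hw
    have hneg : ∀ w, w ∈ Ω ↔ f w < 0 := by
      intro w
      rw [hΩf]; rfl
    have hM0h : 0 ≤ M0 * h := by positivity
    have hray : ∀ w ∈ Ω ∩ ball x0 r, ∀ s : ℝ, 0 ≤ s → s ≤ M0 * h →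
        w + s • e ∈ Ω ∩ ball x0 R := by
      intro w hw s hs hsM
      have h3 := hin w hw.2 s hs hsM
      refine ⟨?_, hRδ _ h3⟩
      rw [hneg]
      have h4 := hdec w (hball w hw.2) s hs h3
      have h5 := (hneg w).1 hw.1
      linarith
    have hray' : ∀ w ∈ Ω ∩ ball x0 r,
        segment ℝ w (w + (M0 * h) • e) ⊆ Ω ∩ ball x0 R := by
      intro w hw z hz
      rw [segment_eq_image'] at hz
      obtain ⟨θ, hθ, rfl⟩ := hz
      simp only [add_sub_cancel_left, smul_smul]
      refine hray w hw _ (mul_nonneg hθ.1 hM0h) ?_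
      nlinarith [hθ.2]
    refine ⟨x + (M0 * h) • e, y + (M0 * h) • e, hray' x hx, ?_, ?_, ?_⟩
    · intro z hz
      rw [segment_eq_image'] at hz
      obtain ⟨θ, hθ, rfl⟩ := hz
      have e1 : x + (M0 * h) • e + θ • (y + (M0 * h) • e - (x + (M0 * h) • e))
          = (x + θ • (y - x)) + (M0 * h) • e := by
        rw [add_sub_add_right_eq_sub]; abel
      simp only [e1]
      have hw : x + θ • (y - x) ∈ ball x0 r := by
        refine (convex_ball x0 r).segment_subset hx.2 hy.2 ?_
        rw [segment_eq_image']
        exact ⟨θ, hθ, rfl⟩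
      have h3 := hin _ hw (M0 * h) hM0h le_rfl
      refine ⟨?_, hRδ _ h3⟩
      rw [hneg]
      have h4 := hdec _ (hball _ hw) _ hM0h h3
      have h5 := hlip _ (hball _ hw) x (hball x hx.2)
      rw [add_sub_cancel_left, norm_smul, Real.norm_eq_abs, abs_of_nonneg hθ.1,
        norm_sub_rev y x, ← hh] at h5
      have h6 := (hneg x).1 hx.1
      have h7 : L * (θ * h) ≤ L * h := by
        refine mul_le_mul_of_nonneg_left ?_ hL0.le
        nlinarith [hθ.2]
      have h8 : M0 * h / 2 = L * h := by rw [hM0]; ring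
      linarith
    · rw [segment_symm]
      exact hray' y hy
    · rw [add_sub_cancel_left, add_sub_add_right_eq_sub, sub_add_cancel_left, norm_neg,
        norm_smul, Real.norm_eq_abs, abs_of_nonneg hM0h, norm_sub_rev y x, ← hh]
      linarith

lemma local_fderiv_bdd {n : ℕ} {Ω : Set (Euc n)} (hΩo : IsOpen Ω) {u : Euc n → Euc n}
    (hu : ContDiffOn ℝ 1 u (closure Ω)) (x0 : Euc n) (hx0 : x0 ∈ closure Ω) :
    ∃ R > 0, ∃ K : ℝ, ∀ y ∈ Ω ∩ ball x0 R, ‖fderiv ℝ u y‖ ≤ K := by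
  have h1 : ContDiffWithinAt ℝ (0 + 1) u (closure Ω) x0 := by simpa using hu x0 hx0
  rw [contDiffWithinAt_succ_iff_hasFDerivWithinAt' (by simp)] at h1
  obtain ⟨U, hU, -, -, f', hf', hc⟩ := h1
  rw [Set.insert_eq_of_mem hx0] at hU
  have h2 : ∀ᶠ y in 𝓝[closure Ω] x0, ‖f' y‖ < ‖f' x0‖ + 1 :=
    hc.continuousWithinAt.norm.eventually_lt_const (lt_add_one _)
  obtain ⟨R, hR, h3⟩ := Metric.mem_nhdsWithin_iff.1 (h2.and hU)
  refine ⟨R, hR, ‖f' x0‖ + 1, fun y hy => ?_⟩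
  have h4 := h3 ⟨hy.2, subset_closure hy.1⟩
  have h5 := (hf' y h4.2).hasFDerivAt
    (mem_of_superset (hΩo.mem_nhds hy.1) subset_closure)
  rw [h5.fderiv]
  exact h4.1.le

lemma local_lip {n : ℕ} {Ω : Set (Euc n)} (hΩo : IsOpen Ω) (hΩs : SmoothBoundary n Ω)
    {u : Euc n → Euc n}
    (hu : ContDiffOn ℝ 1 u (closure Ω)) (x0 : Euc n) (hx0 : x0 ∈ closure Ω) :
    ∃ r > 0, ∃ B : ℝ, 0 ≤ B ∧ ∀ x ∈ Ω ∩ ball x0 r, ∀ y ∈ Ω ∩ ball x0 r,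
      ‖u x - u y‖ ≤ B * ‖x - y‖ := by
  obtain ⟨R, hR, K, hK⟩ := local_fderiv_bdd hΩo hu x0 hx0
  obtain ⟨r, hr, M, h⟩ := local_paths hΩo hΩs x0 hx0 R hR
  refine ⟨r, hr, max K 0 * max M 0, by positivity, fun x hx y hy => ?_⟩
  obtain ⟨p, q, h1, h2, h3, h4⟩ := h x hx y hy
  have hd : ∀ z ∈ Ω, DifferentiableAt ℝ u z := fun z hz =>
    ((hu z (subset_closure hz)).contDiffAt
      (mem_of_superset (hΩo.mem_nhds hz) subset_closure)).differentiableAt (by norm_num)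
  have hseg : ∀ a b, segment ℝ a b ⊆ Ω ∩ ball x0 R → ‖u b - u a‖ ≤ max K 0 * ‖b - a‖ := by
    intro a b hab
    exact Convex.norm_image_sub_le_of_norm_fderiv_le (𝕜 := ℝ) (fun z hz => hd z (hab hz).1)
      (fun z hz => (hK z (hab hz)).trans (le_max_left _ _)) (convex_segment a b)
      (left_mem_segment ℝ a b) (right_mem_segment ℝ a b)
  have e1 := hseg _ _ h1
  have e2 := hseg _ _ h2
  have e3 := hseg _ _ h3
  have e4 : ‖u x - u y‖ ≤ ‖u p - u x‖ + ‖u q - u p‖ + ‖u y - u q‖ := by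
    have : u x - u y = -((u p - u x) + (u q - u p) + (u y - u q)) := by abel
    rw [this, norm_neg]
    exact norm_add₃_le
  calc ‖u x - u y‖ ≤ max K 0 * (‖p - x‖ + ‖q - p‖ + ‖y - q‖) := by linarith
    _ ≤ max K 0 * (max M 0 * ‖x - y‖) := by
      refine mul_le_mul_of_nonneg_left (h4.trans ?_) (le_max_right _ _)
      exact mul_le_mul_of_nonneg_right (le_max_left _ _) (norm_nonneg _)
    _ = _ := by ring

lemma sup_bdd {n : ℕ} {Ω : Set (Euc n)} (hΩb : Bornology.IsBounded Ω) {u : Euc n → Euc n}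
    (hu : ContDiffOn ℝ 1 u (closure Ω)) : BddAbove {r | ∃ x ∈ Ω, r = ‖u x‖} := by
  have hK : IsCompact (closure Ω) := hΩb.isCompact_closure
  obtain ⟨S, hS⟩ := hK.exists_bound_of_continuousOn hu.continuousOn
  refine ⟨S, ?_⟩
  rintro _ ⟨x, hx, rfl⟩
  exact hS x (subset_closure hx)

lemma holder_bdd {n : ℕ} {Ω : Set (Euc n)} (hΩo : IsOpen Ω) (hΩb : Bornology.IsBounded Ω)
    (hΩs : SmoothBoundary n Ω) {u : Euc n → Euc n} (hu : ContDiffOn ℝ 1 u (closure Ω))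
    {α : ℝ} (hα : 0 < α) (hα1 : α < 1) : BddAbove (holderSet n α Ω u) := by
  have hK : IsCompact (closure Ω) := hΩb.isCompact_closure
  obtain ⟨S, hS⟩ := hK.exists_bound_of_continuousOn hu.continuousOn
  have hmain : ∃ B, ∀ z ∈ closure Ω ×ˢ closure Ω, z.1 ∈ Ω → z.2 ∈ Ω →
      ‖u z.1 - u z.2‖ ≤ B * dist z.1 z.2 ^ α := by
    refine (hK.prod hK).induction_on (p := fun A => ∃ B, ∀ z ∈ A, z.1 ∈ Ω → z.2 ∈ Ω →
      ‖u z.1 - u z.2‖ ≤ B * dist z.1 z.2 ^ α) ⟨0, by simp⟩ ?_ ?_ ?_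
    · rintro s t hst ⟨B, h⟩
      exact ⟨B, fun z hz => h z (hst hz)⟩
    · rintro s t ⟨B, h⟩ ⟨B', h'⟩
      refine ⟨max B B', fun z hz h1 h2 => ?_⟩
      have hp : 0 ≤ dist z.1 z.2 ^ α := by positivity
      rcases hz with hz | hz
      · exact (h z hz h1 h2).trans (mul_le_mul_of_nonneg_right (le_max_left _ _) hp)
      · exact (h' z hz h1 h2).trans (mul_le_mul_of_nonneg_right (le_max_right _ _) hp)
    · rintro ⟨x0, y0⟩ ⟨hx0, hy0⟩
      simp only at hx0 hy0
      by_cases hxy : x0 = y0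
      · subst hxy
        obtain ⟨r, hr, B, hB, h⟩ := local_lip hΩo hΩs hu x0 hx0
        refine ⟨ball x0 (min r (1 / 2)) ×ˢ ball x0 (min r (1 / 2)), mem_nhdsWithin_of_mem_nhds
          (prod_mem_nhds (ball_mem_nhds _ (by positivity)) (ball_mem_nhds _ (by positivity))),
          B, ?_⟩
        rintro ⟨x, y⟩ ⟨hx, hy⟩ hxΩ hyΩ
        simp only at hx hy hxΩ hyΩ ⊢
        have h1 := h x ⟨hxΩ, ball_subset_ball (min_le_left _ _) hx⟩ y
          ⟨hyΩ, ball_subset_ball (min_le_left _ _) hy⟩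
        refine h1.trans (mul_le_mul_of_nonneg_left ?_ hB)
        rw [← dist_eq_norm]
        have hd1 : dist x y ≤ 1 := by
          have h2 := mem_ball.1 hx
          have h3 := mem_ball.1 hy
          have h4 := dist_triangle_right x y x0
          have h5 := min_le_right r (1 / 2)
          linarith
        rcases (dist_nonneg (x := x) (y := y)).eq_or_lt with h0 | h0
        · rw [← h0, Real.zero_rpow hα.ne']
        · have := Real.rpow_le_rpow_of_exponent_ge h0 hd1 hα1.le
          rwa [Real.rpow_one] at this
      · have hd : 0 < dist x0 y0 := dist_pos.2 hxy
        set d := dist x0 y0 with hdd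
        refine ⟨ball x0 (d / 3) ×ˢ ball y0 (d / 3), mem_nhdsWithin_of_mem_nhds
          (prod_mem_nhds (ball_mem_nhds _ (by positivity)) (ball_mem_nhds _ (by positivity))),
          (2 * S) / (d / 3) ^ α, ?_⟩
        rintro ⟨x, y⟩ ⟨hx, hy⟩ hxΩ hyΩ
        simp only at hx hy hxΩ hyΩ ⊢
        have h1 := hS x (subset_closure hxΩ)
        have h2 := hS y (subset_closure hyΩ)
        have h3 := norm_sub_le (u x) (u y)
        have hS0 : 0 ≤ S := (norm_nonneg _).trans h1
        have h4 : d / 3 ≤ dist x y := by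
          have e1 := mem_ball.1 hx
          have e2 := mem_ball.1 hy
          have e3 := dist_triangle4 x0 x y y0
          rw [dist_comm x0 x] at e3
          linarith
        have h5 : (d / 3) ^ α ≤ dist x y ^ α := Real.rpow_le_rpow (by positivity) h4 hα.le
        have h6 : 0 < (d / 3) ^ α := by positivity
        rw [div_mul_eq_mul_div, le_div_iff₀ h6]
        refine (mul_le_mul_of_nonneg_right (h3.trans (add_le_add h1 h2)) h6.le).trans ?_
        nlinarith
  obtain ⟨B, hB⟩ := hmain
  refine ⟨B, ?_⟩
  rintro _ ⟨x, hx, y, hy, hxy, rfl⟩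
  rw [div_le_iff₀ (Real.rpow_pos_of_pos (dist_pos.2 hxy) _)]
  exact hB (x, y) ⟨subset_closure hx, subset_closure hy⟩ hx hy

lemma holderNorm_nonneg {n : ℕ} {Ω : Set (Euc n)} (α : ℝ) (u : Euc n → Euc n) :
    0 ≤ holderSemi n α Ω u ∧ 0 ≤ sSup {r | ∃ x ∈ Ω, r = ‖u x‖} := by
  constructor
  · refine Real.sSup_nonneg ?_
    rintro _ ⟨x, hx, y, hy, hxy, rfl⟩
    positivity
  · refine Real.sSup_nonneg ?_
    rintro _ ⟨x, hx, rfl⟩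
    positivity

/-- The Hölder norm controls the map and its increments. -/
lemma holderNorm_spec {n : ℕ} {Ω : Set (Euc n)} (hΩo : IsOpen Ω) (hΩb : Bornology.IsBounded Ω)
    (hΩs : SmoothBoundary n Ω) {u : Euc n → Euc n} (hu : ContDiffOn ℝ 1 u (closure Ω))
    {α : ℝ} (hα : 0 < α) (hα1 : α < 1) :
    0 ≤ holderNorm n α Ω u ∧ (∀ x ∈ Ω, ‖u x‖ ≤ holderNorm n α Ω u) ∧
      ∀ x ∈ Ω, ∀ y ∈ Ω, ‖u x - u y‖ ≤ holderNorm n α Ω u * dist x y ^ α := by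
  obtain ⟨h1, h2⟩ := holderNorm_nonneg (Ω := Ω) α u
  refine ⟨add_nonneg h2 h1, fun x hx => ?_, fun x hx y hy => ?_⟩
  · have := le_csSup (sup_bdd hΩb hu) ⟨x, hx, rfl⟩
    unfold holderNorm
    linarith
  · by_cases hxy : x = y
    · subst hxy
      simp [Real.zero_rpow hα.ne']
    · have h3 : ‖u x - u y‖ / dist x y ^ α ≤ holderSemi n α Ω u :=
        le_csSup (holder_bdd hΩo hΩb hΩs hu hα hα1) ⟨x, hx, y, hy, hxy, rfl⟩
      have h4 : 0 < dist x y ^ α := Real.rpow_pos_of_pos (dist_pos.2 hxy) _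
      rw [div_le_iff₀ h4] at h3
      refine h3.trans (mul_le_mul_of_nonneg_right ?_ h4.le)
      unfold holderNorm
      linarith


lemma jd_congr {n : ℕ} {f g : Fin n → Euc n → ℝ} {x : Euc n} (h : ∀ i, f i =ᶠ[𝓝 x] g i) :
    jd f x = jd g x := by
  unfold jd
  refine Finset.sum_congr rfl fun σ _ => ?_
  congr 1
  refine Finset.prod_congr rfl fun i _ => ?_
  rw [(h i).fderiv_eq]

lemma jd_integrableC {n : ℕ} {g : Fin n → Euc n → ℝ} {ψ : Euc n → ℝ} (hψ : Continuous ψ)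
    (hc : HasCompactSupport ψ) (hg : ∀ i, ∀ x ∈ tsupport ψ, ContDiffAt ℝ 1 (g i) x) :
    Integrable (fun x => jd g x * ψ x) := by
  rw [← integrableOn_iff_integrable_of_support_subset (s := tsupport ψ)]
  · refine ContinuousOn.integrableOn_compact hc ?_
    refine ContinuousOn.mul ?_ hψ.continuousOn
    unfold jd
    refine continuousOn_finsetSum _ fun σ _ => ContinuousOn.mul continuousOn_const ?_
    refine continuousOn_finsetProd _ fun i _ => ?_
    intro x hx
    have h1 : ContinuousAt (fderiv ℝ (g i)) x :=
      ((hg i x hx).fderiv_right (m := 0) (by norm_num)).continuousAt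
    exact (h1.clm_apply continuousAt_const).continuousWithinAt
  · intro x hx
    refine subset_tsupport ψ ?_
    rw [Function.mem_support] at hx ⊢
    exact right_ne_zero_of_mul hx

lemma det_eq_jd {n : ℕ} {u : Euc n → Euc n} {x : Euc n} (hu : DifferentiableAt ℝ u x) :
    (jacMat n u x).det = jd (fun i y => u y i) x := by
  rw [← Matrix.det_transpose, Matrix.det_apply']
  unfold jd
  refine Finset.sum_congr rfl fun σ _ => ?_
  congr 1
  refine Finset.prod_congr rfl fun i _ => ?_
  have h : HasFDerivAt (fun y => u y i)
      ((EuclideanSpace.proj i : Euc n →L[ℝ] ℝ).comp (fderiv ℝ u x)) x :=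
    HasFDerivAt.comp x (g := fun y : Euc n => y i)
      (EuclideanSpace.proj i : Euc n →L[ℝ] ℝ).hasFDerivAt hu.hasFDerivAt
  rw [h.fderiv]
  simp [jacMat]

lemma int_det_eq {n : ℕ} {Ω : Set (Euc n)} (hΩo : IsOpen Ω) {u : Euc n → Euc n}
    (hu : ContDiffOn ℝ 1 u (closure Ω)) {ψ : Euc n → ℝ} (hψ : tsupport ψ ⊆ Ω) :
    ∫ x in Ω, (jacMat n u x).det * ψ x = ∫ x, jd (fun i y => u y i) x * ψ x := by
  rw [← setIntegral_eq_integral_of_forall_compl_eq_zero (s := Ω) (μ := volume)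
    (f := fun x => jd (fun i y => u y i) x * ψ x)]
  · refine setIntegral_congr_fun hΩo.measurableSet fun x hx => ?_
    have : DifferentiableAt ℝ u x :=
      ((hu.mono subset_closure).contDiffAt (hΩo.mem_nhds hx)).differentiableAt one_ne_zero
    simp only [det_eq_jd this]
  · intro x hx
    rw [image_eq_zero_of_notMem_tsupport (fun h => hx (hψ h)), mul_zero]

/-- The estimate for scalar components which are Hölder on `Ω`. -/
lemma jd_key_on {n : ℕ} {Ω : Set (Euc n)} (hΩo : IsOpen Ω) {α : ℝ} (hα0 : 0 < α) (hα₂ : α < 1)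
    {C : ℝ} (hC : ∀ (f : Fin n → Euc n → ℝ) (N : Fin n → ℝ) (ψ : Euc n → ℝ), (∀ i, 0 ≤ N i) →
      ContDiff ℝ 1 ψ → HasCompactSupport ψ →
      (∀ i x y, |f i x - f i y| ≤ N i * dist x y ^ α) →
      (∀ i, ∀ x ∈ tsupport ψ, |f i x| ≤ N i) →
      (∀ i, ∀ x ∈ tsupport ψ, ContDiffAt ℝ 1 (f i) x) →
      |∫ x, jd f x * ψ x| ≤ C * (∏ i, N i) * ∫ x, ‖fderiv ℝ ψ x‖)
    (f : Fin n → Euc n → ℝ) (N : Fin n → ℝ) (ψ : Euc n → ℝ) (hN : ∀ i, 0 ≤ N i)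
    (hψ : Cc1 n Ω ψ)
    (h1 : ∀ i, ∀ x ∈ Ω, ∀ y ∈ Ω, |f i x - f i y| ≤ N i * dist x y ^ α)
    (h2 : ∀ i, ∀ x ∈ Ω, |f i x| ≤ N i)
    (h3 : ∀ i, ∀ x ∈ Ω, ContDiffAt ℝ 1 (f i) x) :
    |∫ x, jd f x * ψ x| ≤ C * (∏ i, N i) * ∫ x in Ω, ‖fderiv ℝ ψ x‖ := by
  obtain ⟨hψ1, hψ2, hψ3⟩ := hψ
  choose G hG1 hG2 using fun i => holder_ext hα0 hα₂ (hN i) Ω (f i) (h1 i)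
  have hev : ∀ i, ∀ x ∈ Ω, G i =ᶠ[𝓝 x] f i := fun i x hx => by
    filter_upwards [hΩo.mem_nhds hx] with y hy using hG1 i y hy
  have e1 : ∫ x, jd f x * ψ x = ∫ x, jd G x * ψ x := by
    refine integral_congr_ae (Eventually.of_forall fun x => ?_)
    by_cases hx : x ∈ Ω
    · simp only [jd_congr fun i => hev i x hx]
    · simp only [image_eq_zero_of_notMem_tsupport (fun h => hx (hψ3 h)), mul_zero]
  have e2 : ∫ x in Ω, ‖fderiv ℝ ψ x‖ = ∫ x, ‖fderiv ℝ ψ x‖ := by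
    refine setIntegral_eq_integral_of_forall_compl_eq_zero fun x hx => ?_
    have : x ∉ tsupport (fderiv ℝ ψ) := fun h => hx (hψ3 (tsupport_fderiv_subset ℝ h))
    rw [image_eq_zero_of_notMem_tsupport this, norm_zero]
  rw [e1, e2]
  refine hC G N ψ hN hψ1 hψ2 hG2 (fun i x hx => ?_) (fun i x hx => ?_)
  · rw [hG1 i x (hψ3 hx)]; exact h2 i x (hψ3 hx)
  · exact (h3 i x (hψ3 hx)).congr_of_eventuallyEq (hev i x (hψ3 hx))

lemma comp_abs_le {n : ℕ} (w : Euc n) (i : Fin n) : |w i| ≤ ‖w‖ := by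
  have := PiLp.norm_apply_le w i
  rwa [Real.norm_eq_abs] at this

/-- The Hölder estimate for distributional Jacobians. -/
theorem jacobian_estimate_holder
    (n : ℕ) (hn : 2 ≤ n) (Ω : Set (Euc n)) (hΩo : IsOpen Ω)
    (hΩb : Bornology.IsBounded Ω) (hΩs : SmoothBoundary n Ω)
    (α : ℝ) (hα₁ : ((n : ℝ) - 1) / n < α) (hα₂ : α < 1) :
    ∃ C : ℝ, 0 < C ∧ ∀ (u v : Euc n → Euc n) (ψ : Euc n → ℝ),
      ContDiffOn ℝ 1 u (closure Ω) → ContDiffOn ℝ 1 v (closure Ω) → Cc1 n Ω ψ →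
      |(∫ x in Ω, (jacMat n u x).det * ψ x) - ∫ x in Ω, (jacMat n v x).det * ψ x| ≤
        C * holderNorm n α Ω (u - v) *
          (holderNorm n α Ω u + holderNorm n α Ω v) ^ (n - 1) *
          ∫ x in Ω, ‖fderiv ℝ ψ x‖ := by


  have hn0 : (0 : ℝ) < n := by positivity
  have hn2 : (2 : ℝ) ≤ n := by exact_mod_cast hn
  have hα0 : 0 < α := lt_of_le_of_lt (div_nonneg (by linarith) hn0.le) hα₁
  have hαn : (n : ℝ) - 1 < n * α := by
    rw [div_lt_iff₀ hn0] at hα₁; linarith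
  obtain ⟨C, hC0, hC⟩ := jd_key n (by omega) α hα0 hαn hα₂
  refine ⟨n * C, by positivity, fun u v ψ hu hv hψ => ?_⟩
  have hψ' := hψ
  obtain ⟨hψ1, hψ2, hψ3⟩ := hψ'
  rw [int_det_eq hΩo hu hψ3, int_det_eq hΩo hv hψ3]
  have huv : ContDiffOn ℝ 1 (u - v) (closure Ω) := hu.sub hv
  obtain ⟨u0, u1, u2⟩ := holderNorm_spec hΩo hΩb hΩs hu hα0 hα₂
  obtain ⟨v0, v1, v2⟩ := holderNorm_spec hΩo hΩb hΩs hv hα0 hα₂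
  obtain ⟨w0, w1, w2⟩ := holderNorm_spec hΩo hΩb hΩs huv hα0 hα₂
  generalize holderNorm n α Ω u = U at *
  generalize holderNorm n α Ω v = V at *
  generalize holderNorm n α Ω (u - v) = W at *
  have cd : ∀ w : Euc n → Euc n, ContDiffOn ℝ 1 w (closure Ω) → ∀ i, ∀ x ∈ Ω,
      ContDiffAt ℝ 1 (fun y => w y i) x := by
    intro w hw i x hx
    have h := (hw.mono subset_closure).contDiffAt (hΩo.mem_nhds hx)
    exact (EuclideanSpace.proj i : Euc n →L[ℝ] ℝ).contDiff.contDiffAt.comp x h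
  have hmain := telesc (fun g : Fin n → Euc n → ℝ => ∫ x, jd g x * ψ x)
    (fun i y => u y i) (fun i y => v y i)
    (C * (W * (U + V) ^ (n - 1)) * ∫ x in Ω, ‖fderiv ℝ ψ x‖) ?_
  · refine hmain.trans (le_of_eq ?_)
    ring
  intro h hh j
  have hhc : ∀ i, ∀ x ∈ Ω, ContDiffAt ℝ 1 (h i) x := by
    intro i x hx
    rcases hh i with e | e <;> rw [e]
    · exact cd u hu i x hx
    · exact cd v hv i x hx
  have hup : ∀ a : Euc n → ℝ, (∀ x ∈ Ω, ContDiffAt ℝ 1 a x) →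
      ∀ i, ∀ x ∈ Ω, ContDiffAt ℝ 1 (Function.update h j a i) x := by
    intro a ha i x hx
    by_cases hi : i = j
    · subst hi; simpa using ha x hx
    · simpa [Function.update_of_ne hi] using hhc i x hx
  simp only
  rw [← integral_sub
    (jd_integrableC hψ1.continuous hψ2 fun i x hx => hup _ (cd u hu j) i x (hψ3 hx))
    (jd_integrableC hψ1.continuous hψ2 fun i x hx => hup _ (cd v hv j) i x (hψ3 hx))]
  have e1 : ∀ x, jd (Function.update h j (fun y => u y j)) x * ψ x
      - jd (Function.update h j (fun y => v y j)) x * ψ x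
      = jd (Function.update h j ((fun y => u y j) - fun y => v y j)) x * ψ x := by
    intro x
    by_cases hx : x ∈ Ω
    · rw [jd_update_sub h j _ _ x ((cd u hu j x hx).differentiableAt one_ne_zero)
        ((cd v hv j x hx).differentiableAt one_ne_zero)]
      ring
    · simp only [image_eq_zero_of_notMem_tsupport (fun h => hx (hψ3 h)), mul_zero, sub_zero]
  simp only [e1]
  have hprod : ∏ i, Function.update (fun _ : Fin n => U + V) j W i = W * (U + V) ^ (n - 1) := by
    rw [Finset.prod_update_of_mem (Finset.mem_univ j), Finset.prod_const]
    congr 2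
    rw [Finset.card_sdiff_of_subset (by simp)]
    simp
  rw [← hprod]
  refine jd_key_on hΩo hα0 hα₂ hC _ _ ψ ?_ hψ ?_ ?_ ?_
  · intro i
    by_cases hi : i = j
    · subst hi; simpa using w0
    · simpa [Function.update_of_ne hi] using add_nonneg u0 v0
  · intro i x hx y hy
    by_cases hi : i = j
    · subst hi
      have := (comp_abs_le ((u - v) x - (u - v) y) i).trans (w2 x hx y hy)
      simpa using this
    · rw [Function.update_of_ne hi, Function.update_of_ne hi]
      have hd : 0 ≤ dist x y ^ α := by positivity
      rcases hh i with e | e <;> rw [e]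
      · have := (comp_abs_le (u x - u y) i).trans (u2 x hx y hy)
        simp only [PiLp.sub_apply] at this
        nlinarith [mul_nonneg v0 hd]
      · have := (comp_abs_le (v x - v y) i).trans (v2 x hx y hy)
        simp only [PiLp.sub_apply] at this
        nlinarith [mul_nonneg u0 hd]
  · intro i x hx
    by_cases hi : i = j
    · subst hi
      have := (comp_abs_le ((u - v) x) i).trans (w1 x hx)
      simpa using this
    · rw [Function.update_of_ne hi, Function.update_of_ne hi]
      rcases hh i with e | e <;> rw [e]
      · have := (comp_abs_le (u x) i).trans (u1 x hx)
        simp only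
        linarith
      · have := (comp_abs_le (v x) i).trans (v1 x hx)
        simp only
        linarith
  · exact hup _ fun x hx => (cd u hu j x hx).sub (cd v hv j x hx)

end
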